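/- Generation of the interface (periodic setting). Let u_0 ∈ C^2(R^N) be Z^N-periodic, set C_0 := ||u_0||_∞ + ||∇u_0||_∞ + ||Δu_0||_∞, μ := f'(α), t^ε := μ^{-1} ε^2 |ln ε|, and η_0 := min(α - α_-, α_+ - α). Let η be any constant with 0 < η < η_0. Then there exist positive constants ε_0 and M_0 such that for every ε ∈ (0, ε_0) and every Z^N-periodic C^{2,1} solution u^ε of u_t = Δφ(u) + ε^{-2} f(u) on R^N × (0,∞) with u^ε(·,0) = u_0, the following hold: (i) α_- - η ≤ u^ε(x, t^ε) ≤ α_+ + η for all x ∈ R^N; (ii) if u_0(x) ≥ α + M_0 ε then u^ε(x, t^ε) ≥ α_+ - η; (iii) if u_0(x) ≤ α - M_0 ε then u^ε(x, t^ε) ≤ α_- + η. -/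

import Mathlib

open MeasureTheory Real Set Filter

/-- The Laplacian of `g : ℝ^N → ℝ` at `x`, as the sum of the pure second
derivatives in the coordinate directions. -/
noncomputable def lap {N : ℕ} (g : EuclideanSpace ℝ (Fin N) → ℝ)
    (x : EuclideanSpace ℝ (Fin N)) : ℝ :=
  ∑ i : Fin N, iteratedFDeriv ℝ 2 g x ![EuclideanSpace.single i 1, EuclideanSpace.single i 1]

/-- A function of space and time is `ℤ^N`-periodic in space. -/
def SpacePeriodic {N : ℕ} (w : EuclideanSpace ℝ (Fin N) → ℝ → ℝ) : Prop :=
  ∀ (x : EuclideanSpace ℝ (Fin N)) (t : ℝ) (k : Fin N → ℤ),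
    w (x + (EuclideanSpace.equiv (Fin N) ℝ).symm (fun i => (k i : ℝ))) t = w x t

/-- A spatial function is `ℤ^N`-periodic. -/
def SpacePeriodicFn {N : ℕ} (w : EuclideanSpace ℝ (Fin N) → ℝ) : Prop :=
  ∀ (x : EuclideanSpace ℝ (Fin N)) (k : Fin N → ℤ),
    w (x + (EuclideanSpace.equiv (Fin N) ℝ).symm (fun i => (k i : ℝ))) = w x

/-- `C^{2,1}` regularity on `ℝ^N × [0,∞)`. -/
def C21 {N : ℕ} (w : EuclideanSpace ℝ (Fin N) → ℝ → ℝ) : Prop :=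
  Continuous (fun p : EuclideanSpace ℝ (Fin N) × ℝ => w p.1 p.2) ∧
  (∀ t : ℝ, 0 ≤ t → ContDiff ℝ 2 (fun x => w x t)) ∧
  (∀ x : EuclideanSpace ℝ (Fin N), ContDiffOn ℝ 1 (fun t => w x t) (Ici 0))

/-- Second-order necessary condition at a local minimum, along a fixed direction. -/
lemma IsLocalMin.iteratedFDeriv_two_nonneg {E : Type*} [NormedAddCommGroup E] [NormedSpace ℝ E]
    {g : E → ℝ} {x : E} (hg : ContDiffAt ℝ 2 g x) (hmin : IsLocalMin g x) (e : E) :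
    0 ≤ iteratedFDeriv ℝ 2 g x ![e, e] := by
  have hline : ∀ s : ℝ, HasDerivAt (fun s : ℝ => x + s • e) e s := fun s => by
    simpa using ((hasDerivAt_id s).smul_const e).const_add x
  have hcont : Filter.Tendsto (fun s : ℝ => x + s • e) (nhds 0) (nhds x) := by
    simpa [ContinuousAt] using (hline 0).continuousAt
  have hd1 : ∀ᶠ s in nhds (0 : ℝ),
      deriv (fun s : ℝ => g (x + s • e)) s = fderiv ℝ g (x + s • e) e := by
    have h := hg.eventually (by simp)
    filter_upwards [hcont.eventually h] with s hs
    exact ((hs.differentiableAt (by norm_num)).hasFDerivAt.comp_hasDerivAt s (hline s)).deriv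
  have hd2 : HasDerivAt (fun s : ℝ => fderiv ℝ g (x + s • e) e)
      (iteratedFDeriv ℝ 2 g x ![e, e]) 0 := by
    have hf : HasFDerivAt (fderiv ℝ g) (fderiv ℝ (fderiv ℝ g) x) (x + (0 : ℝ) • e) := by
      simpa using ((hg.fderiv_right (m := 1) (by norm_num)).differentiableAt
        (by norm_num)).hasFDerivAt
    have h1 : HasDerivAt (fun s : ℝ => fderiv ℝ g (x + s • e)) (fderiv ℝ (fderiv ℝ g) x e) 0 :=
      hf.comp_hasDerivAt (0 : ℝ) (hline 0)
    rw [iteratedFDeriv_two_apply]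
    exact (ContinuousLinearMap.apply ℝ ℝ e).hasFDerivAt.comp_hasDerivAt (0 : ℝ) h1
  have hdd : deriv (deriv (fun s : ℝ => g (x + s • e))) 0 = iteratedFDeriv ℝ 2 g x ![e, e] := by
    rw [Filter.EventuallyEq.deriv_eq hd1, hd2.deriv]
  have hloc : IsLocalMin (fun s : ℝ => g (x + s • e)) 0 := by
    have := hcont.eventually hmin
    simpa [IsLocalMin, IsMinFilter] using this
  by_contra! hneg
  have hca : ContinuousAt (fun s : ℝ => g (x + s • e)) 0 := by
    have : ContinuousAt g (x + (0 : ℝ) • e) := by simpa using hg.continuousAt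
    exact ContinuousAt.comp (f := fun s : ℝ => x + s • e) this (hline 0).continuousAt
  have hmax : IsLocalMax (fun s : ℝ => g (x + s • e)) 0 :=
    isLocalMax_of_deriv_deriv_neg (by rw [hdd]; exact hneg) hloc.deriv_eq_zero hca
  have hconst : (fun s : ℝ => g (x + s • e)) =ᶠ[nhds 0] fun _ => g (x + (0 : ℝ) • e) := by
    filter_upwards [hloc, hmax] with s h1 h2
    exact le_antisymm h2 h1
  have h0 : deriv (deriv (fun s : ℝ => g (x + s • e))) 0 = 0 := by
    rw [hconst.deriv.deriv_eq]
    simp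
  rw [hdd] at h0
  exact hneg.ne h0

/-- Comparison of Laplacians of two functions touching at a point. -/
lemma lap_le_lap_of_touch {N : ℕ} {g₁ g₂ : EuclideanSpace ℝ (Fin N) → ℝ}
    {x : EuclideanSpace ℝ (Fin N)} (h₁ : ContDiffAt ℝ 2 g₁ x) (h₂ : ContDiffAt ℝ 2 g₂ x)
    (heq : g₁ x = g₂ x) (hle : ∀ᶠ y in nhds x, g₁ y ≤ g₂ y) : lap g₁ x ≤ lap g₂ x := by
  refine Finset.sum_le_sum fun i _ => ?_
  have hmin : IsLocalMin (g₂ - g₁) x := by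
    filter_upwards [hle] with y hy
    simp only [Pi.sub_apply]
    linarith
  have h := hmin.iteratedFDeriv_two_nonneg (h₂.sub h₁) (EuclideanSpace.single i 1)
  change 0 ≤ iteratedFDeriv ℝ 2 (g₂ - g₁) x _ at h
  rw [iteratedFDeriv_sub_apply h₂ h₁] at h
  simpa using h

/-- Second-order chain rule along a fixed direction. -/
lemma iteratedFDeriv_two_comp_apply {E : Type*} [NormedAddCommGroup E] [NormedSpace ℝ E]
    {v : E → ℝ} {x : E} (hv : ContDiff ℝ 2 v) {Ψ Ψ₁ : ℝ → ℝ} {Ψ₂ : ℝ}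
    (h1 : ∀ᶠ s in nhds (v x), HasDerivAt Ψ (Ψ₁ s) s) (h2 : HasDerivAt Ψ₁ Ψ₂ (v x)) (e : E) :
    iteratedFDeriv ℝ 2 (fun y => Ψ (v y)) x ![e, e]
      = Ψ₂ * (fderiv ℝ v x e) ^ 2 + Ψ₁ (v x) * iteratedFDeriv ℝ 2 v x ![e, e] := by
  have hvd : ∀ y, HasFDerivAt v (fderiv ℝ v y) y := fun y =>
    (hv.differentiable (by norm_num) y).hasFDerivAt
  have hev : fderiv ℝ (fun y => Ψ (v y)) =ᶠ[nhds x] fun y => Ψ₁ (v y) • fderiv ℝ v y := by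
    filter_upwards [hv.continuous.continuousAt.eventually h1] with y hy
    exact (hy.comp_hasFDerivAt y (hvd y)).fderiv
  have hff : HasFDerivAt (fderiv ℝ v) (fderiv ℝ (fderiv ℝ v) x) x :=
    ((hv.fderiv_right (m := 1) (by norm_num)).differentiable (by norm_num) x).hasFDerivAt
  have hprod : HasFDerivAt (fun y => Ψ₁ (v y) • fderiv ℝ v y) _ x :=
    (h2.comp_hasFDerivAt x (hvd x)).smul hff
  rw [iteratedFDeriv_two_apply, iteratedFDeriv_two_apply, hev.fderiv_eq,
    hprod.fderiv]
  simp
  ring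

/-- Some compact set meets every `ℤ^N`-orbit. -/
lemma exists_compact_fundamental_domain {N : ℕ} :
    ∃ K : Set (EuclideanSpace ℝ (Fin N)), IsCompact K ∧
      ∀ x : EuclideanSpace ℝ (Fin N), ∃ k : Fin N → ℤ,
        x + (EuclideanSpace.equiv (Fin N) ℝ).symm (fun i => (k i : ℝ)) ∈ K := by
  refine ⟨(EuclideanSpace.equiv (Fin N) ℝ).symm '' Icc 0 1,
    isCompact_Icc.image (EuclideanSpace.equiv (Fin N) ℝ).symm.continuous, fun x => ?_⟩
  refine ⟨fun i => -⌊x i⌋, fun i => Int.fract (x i), ⟨fun i => Int.fract_nonneg _,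
    fun i => (Int.fract_lt_one _).le⟩, ?_⟩
  ext i
  simp [Int.fract, sub_eq_add_neg]

/-- A continuous `ℤ^N`-periodic function is bounded. -/
lemma SpacePeriodicFn.bounded {N : ℕ} {g : EuclideanSpace ℝ (Fin N) → ℝ}
    (hper : SpacePeriodicFn g) (hg : Continuous g) : ∃ C : ℝ, ∀ x, |g x| ≤ C := by
  obtain ⟨K, hK, hcov⟩ := exists_compact_fundamental_domain (N := N)
  obtain ⟨C, hC⟩ := hK.exists_bound_of_continuousOn hg.continuousOn
  refine ⟨C, fun x => ?_⟩
  obtain ⟨k, hk⟩ := hcov x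
  have h := hC _ hk
  rwa [hper x k, Real.norm_eq_abs] at h

/-- A `C²` periodic function is bounded together with its first and second derivatives. -/
lemma SpacePeriodicFn.exists_bound {N : ℕ} {v : EuclideanSpace ℝ (Fin N) → ℝ}
    (hper : SpacePeriodicFn v) (hv : ContDiff ℝ 2 v) :
    ∃ Λ > (0 : ℝ), ∀ x, |v x| ≤ Λ ∧ ∀ i : Fin N,
      |fderiv ℝ v x (EuclideanSpace.single i 1)| ≤ Λ ∧
      |iteratedFDeriv ℝ 2 v x ![EuclideanSpace.single i 1, EuclideanSpace.single i 1]| ≤ Λ := by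
  have hshift : ∀ k : Fin N → ℤ,
      (fun x => v (x + (EuclideanSpace.equiv (Fin N) ℝ).symm (fun i => (k i : ℝ)))) = v :=
    fun k => funext fun x => hper x k
  obtain ⟨C₀, h₀⟩ := hper.bounded hv.continuous
  have h1 : ∀ i : Fin N, ∃ C, ∀ x, |fderiv ℝ v x (EuclideanSpace.single i 1)| ≤ C := fun i => by
    refine SpacePeriodicFn.bounded (fun x k => ?_)
      ((hv.continuous_fderiv (by norm_num)).clm_apply continuous_const)
    rw [← fderiv_comp_add_right, hshift k]
  have h2 : ∀ i : Fin N, ∃ C, ∀ x,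
      |iteratedFDeriv ℝ 2 v x ![EuclideanSpace.single i 1, EuclideanSpace.single i 1]| ≤ C :=
    fun i => by
    refine SpacePeriodicFn.bounded (fun x k => ?_) ?_
    · rw [← iteratedFDeriv_comp_add_right, hshift k]
    · exact (ContinuousMultilinearMap.apply ℝ (fun _ : Fin 2 => EuclideanSpace ℝ (Fin N)) ℝ
        ![EuclideanSpace.single i 1, EuclideanSpace.single i 1]).continuous.comp
        (hv.continuous_iteratedFDeriv (m := 2) le_rfl)
  choose C₁ h₁ using h1
  choose C₂ h₂ using h2
  refine ⟨1 + |C₀| + ∑ i, |C₁ i| + ∑ i, |C₂ i|, by positivity, fun x => ?_⟩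
  have s1 : 0 ≤ ∑ i, |C₁ i| := by positivity
  have s2 : 0 ≤ ∑ i, |C₂ i| := by positivity
  refine ⟨by linarith [h₀ x, le_abs_self C₀], fun i => ⟨?_, ?_⟩⟩
  · have := Finset.single_le_sum (f := fun i => |C₁ i|) (fun i _ => abs_nonneg _)
      (Finset.mem_univ i)
    linarith [h₁ i x, le_abs_self (C₁ i), abs_nonneg C₀]
  · have := Finset.single_le_sum (f := fun i => |C₂ i|) (fun i _ => abs_nonneg _)
      (Finset.mem_univ i)
    linarith [h₂ i x, le_abs_self (C₂ i), abs_nonneg C₀]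

/-- First-touching principle: a continuous space-periodic function that is positive initially
and cannot vanish for a first time stays positive. -/
lemma pos_of_no_first_zero {N : ℕ} {F : EuclideanSpace ℝ (Fin N) → ℝ → ℝ} {T : ℝ}
    (hF : Continuous fun p : EuclideanSpace ℝ (Fin N) × ℝ => F p.1 p.2)
    (hper : SpacePeriodic F) (h0 : ∀ x, 0 < F x 0)
    (hno : ∀ x₀ t₀, 0 < t₀ → t₀ ≤ T → F x₀ t₀ = 0 → (∀ x t, 0 ≤ t → t ≤ t₀ → 0 ≤ F x t) → False) :
    ∀ x t, 0 ≤ t → t ≤ T → 0 < F x t := by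
  by_contra! hcon
  obtain ⟨x₁, t₁, ht0, htT, hF1⟩ := hcon
  obtain ⟨K, hK, hcov⟩ := exists_compact_fundamental_domain (N := N)
  have hmove : ∀ x t, ∃ y ∈ K, F y t = F x t := fun x t => by
    obtain ⟨k, hk⟩ := hcov x
    exact ⟨_, hk, hper x t k⟩
  have hcomp : IsCompact ((K ×ˢ Icc (0 : ℝ) T) ∩ {p | F p.1 p.2 ≤ 0}) :=
    (hK.prod isCompact_Icc).inter_right (isClosed_le hF continuous_const)
  obtain ⟨y₁, hy₁, hy₁F⟩ := hmove x₁ t₁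
  obtain ⟨⟨x₀, t₀⟩, ⟨⟨hx₀, ht₀⟩, hF0⟩, hmin⟩ := hcomp.exists_isMinOn
    ⟨(y₁, t₁), ⟨hy₁, ht0, htT⟩, by simpa [hy₁F] using hF1⟩
    (continuous_snd.continuousOn (s := (K ×ˢ Icc (0 : ℝ) T) ∩ {p | F p.1 p.2 ≤ 0}))
  simp only [mem_ofPred_eq] at hF0 hx₀ ht₀
  have hbefore : ∀ x t, 0 ≤ t → t < t₀ → 0 < F x t := by
    intro x t ht htt
    by_contra! hle
    obtain ⟨y, hy, hyF⟩ := hmove x t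
    have := hmin (show (y, t) ∈ (K ×ˢ Icc (0 : ℝ) T) ∩ {p | F p.1 p.2 ≤ 0} from
      ⟨⟨hy, ht, htt.le.trans ht₀.2⟩, by simpa [hyF] using hle⟩)
    simp only [mem_ofPred_eq] at this
    linarith
  have htpos : 0 < t₀ := by
    rcases ht₀.1.eq_or_lt with h | h
    · exact absurd hF0 (by rw [← h]; exact not_le.2 (h0 x₀))
    · exact h
  have hat : ∀ x, 0 ≤ F x t₀ := by
    intro x
    have hc : Continuous fun t => F x t := hF.comp (by fun_prop : Continuous fun t : ℝ => (x, t))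
    have hlim : Filter.Tendsto (fun t => F x t) (nhdsWithin t₀ (Iio t₀)) (nhds (F x t₀)) :=
      (hc.tendsto t₀).mono_left nhdsWithin_le_nhds
    refine ge_of_tendsto hlim ?_
    filter_upwards [Ioo_mem_nhdsLT htpos] with t ht
    exact (hbefore x t ht.1.le ht.2).le
  refine hno x₀ t₀ htpos ht₀.2 (le_antisymm hF0 (hat x₀)) fun x t ht htt => ?_
  rcases htt.eq_or_lt with h | h
  · rw [h]; exact hat x
  · exact (hbefore x t ht h).le

/-- At a point where the solution is touched from below for the first time by a test function,
the test function is a supersolution. -/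
lemma le_deriv_of_touch_below {N : ℕ} {f φ : ℝ → ℝ} {c : ℝ}
    {u w : EuclideanSpace ℝ (Fin N) → ℝ → ℝ}
    {x₀ : EuclideanSpace ℝ (Fin N)} {t₀ w' : ℝ} (hu : C21 u) (ht₀ : 0 < t₀)
    (hpde : deriv (fun s => u x₀ s) t₀ = lap (fun y => φ (u y t₀)) x₀ + c * f (u x₀ t₀))
    (hφ : ContDiff ℝ 2 φ) (hmono : Monotone φ) (heq : w x₀ t₀ = u x₀ t₀)
    (hx : ∀ᶠ y in nhds x₀, w y t₀ ≤ u y t₀)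
    (ht : ∀ᶠ t in nhdsWithin t₀ (Iio t₀), w x₀ t ≤ u x₀ t)
    (hw : HasDerivAt (fun t => w x₀ t) w' t₀)
    (hw2 : ContDiffAt ℝ 2 (fun y => φ (w y t₀)) x₀) :
    lap (fun y => φ (w y t₀)) x₀ + c * f (w x₀ t₀) ≤ w' := by
  have hlap : lap (fun y => φ (w y t₀)) x₀ ≤ lap (fun y => φ (u y t₀)) x₀ := by
    refine lap_le_lap_of_touch hw2 (hφ.comp (hu.2.1 t₀ ht₀.le)).contDiffAt (by simp [heq]) ?_
    filter_upwards [hx] with y hy using hmono hy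
  have hud : HasDerivAt (fun t => u x₀ t) (deriv (fun s => u x₀ s) t₀) t₀ :=
    (((hu.2.2 x₀).differentiableOn (by norm_num) t₀ ht₀.le).differentiableAt
      (Ici_mem_nhds ht₀)).hasDerivAt
  have hd : HasDerivWithinAt (fun t => u x₀ t - w x₀ t) (deriv (fun s => u x₀ s) t₀ - w')
      (Iio t₀) t₀ := (hud.sub hw).hasDerivWithinAt
  have hle : deriv (fun s => u x₀ s) t₀ - w' ≤ 0 := by
    rw [hasDerivWithinAt_iff_tendsto_slope' (by simp)] at hd
    refine le_of_tendsto hd ?_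
    filter_upwards [ht, self_mem_nhdsWithin] with t h1 h2
    rw [slope_def_field]
    refine div_nonpos_of_nonneg_of_nonpos ?_ (by simp only [mem_Iio] at h2; linarith)
    linarith
  rw [hpde] at hle
  rw [heq]
  linarith

/-- Quadratic Taylor lower bound at a zero of a `C²` function, uniform on a compact interval. -/
lemma exists_quadratic_lower_bound {f : ℝ → ℝ} (hf : ContDiff ℝ 2 f) {c : ℝ} (hc : f c = 0)
    (a b : ℝ) (hac : a ≤ c) (hcb : c ≤ b) :
    ∃ K > (0 : ℝ), ∀ s ∈ Icc a b, deriv f c * (s - c) - K * (s - c) ^ 2 ≤ f s := by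
  have hf1 : ContDiff ℝ 1 (deriv f) := by
    have : ContDiff ℝ (1 + 1) f := by simpa [one_add_one_eq_two] using hf
    exact (contDiff_succ_iff_deriv.1 this).2.2
  obtain ⟨K, hK⟩ := isCompact_Icc.exists_bound_of_continuousOn (s := Icc a b)
    (hf1.continuous_deriv le_rfl).continuousOn
  have hlip : ∀ s ∈ Icc a b, |deriv f s - deriv f c| ≤ K * |s - c| := fun s hs =>
    (convex_Icc a b).norm_image_sub_le_of_norm_deriv_le
      (fun x _ => hf1.differentiable (by norm_num) x) hK ⟨hac, hcb⟩ hs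
  refine ⟨|K| + 1, by positivity, fun s hs => ?_⟩
  have hsub : uIcc c s ⊆ Icc a b := uIcc_subset_Icc ⟨hac, hcb⟩ hs
  have hmv := (convex_uIcc c s).norm_image_sub_le_of_norm_hasDerivWithin_le
    (f := fun y => f y - deriv f c * y) (f' := fun y => deriv f y - deriv f c)
    (C := |K| * |s - c|)
    (fun y _ => by
      have h := ((hf.differentiable (by norm_num) y).hasDerivAt.sub
        ((hasDerivAt_id y).const_mul (deriv f c))).hasDerivWithinAt (s := uIcc c s)
      rw [mul_one] at h
      exact h)
    (fun y hy => by
      have h1 := hlip y (hsub hy)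
      have h2 : |y - c| ≤ |s - c| := abs_sub_left_of_mem_uIcc hy
      calc ‖deriv f y - deriv f c‖ ≤ K * |y - c| := h1
        _ ≤ |K| * |y - c| := by gcongr; exact le_abs_self K
        _ ≤ |K| * |s - c| := by gcongr)
    left_mem_uIcc right_mem_uIcc
  simp only [Real.norm_eq_abs] at hmv
  rw [mul_assoc, ← sq, sq_abs] at hmv
  have := (abs_le.1 hmv).1
  nlinarith [sq_nonneg (s - c)]

/-- A continuous function with a zero of positive slope at `c` and no zero in `(c, p)` is
positive on `(c, p)`. -/
lemma pos_on_Ioo_of_deriv_pos {f : ℝ → ℝ} (hf : Continuous f) {c p : ℝ} (hc : f c = 0)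
    (hd : 0 < deriv f c) (hne : ∀ s ∈ Ioo c p, f s ≠ 0) : ∀ s ∈ Ioo c p, 0 < f s := by
  intro s hs
  by_contra! hle
  have hdiff : DifferentiableAt ℝ f c := differentiableAt_of_deriv_ne_zero hd.ne'
  have hsl := hasDerivAt_iff_tendsto_slope.1 hdiff.hasDerivAt
  have hev : ∀ᶠ y in nhdsWithin c (Ioi c), 0 < slope f c y :=
    (hsl.mono_left (nhdsWithin_mono _ fun y hy => ne_of_gt hy)).eventually (lt_mem_nhds hd)
  obtain ⟨y, hy, hyc, hys⟩ := (hev.and (Ioo_mem_nhdsGT hs.1)).exists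
  have hfy : 0 < f y := by
    rw [slope_def_field, hc, sub_zero] at hy
    exact (div_pos_iff_of_pos_right (sub_pos.2 hyc)).1 hy
  obtain ⟨z, hz, hz0⟩ := intermediate_value_Icc' hys.le hf.continuousOn
    (show (0 : ℝ) ∈ Icc (f s) (f y) from ⟨hle, hfy.le⟩)
  exact hne z ⟨hyc.trans_le hz.1, hz.2.trans_lt hs.2⟩ hz0

/-- A continuous function positive on a compact interval is bounded below by a positive
constant there. -/
lemma exists_pos_lower_bound {f : ℝ → ℝ} (hf : Continuous f) (a b : ℝ)
    (hpos : ∀ s ∈ Icc a b, 0 < f s) : ∃ m > (0 : ℝ), ∀ s ∈ Icc a b, m ≤ f s := by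
  rcases (Icc a b).eq_empty_or_nonempty with h | h
  · exact ⟨1, one_pos, by simp [h]⟩
  · obtain ⟨s, hs, hmin⟩ := isCompact_Icc.exists_isMinOn h hf.continuousOn
    exact ⟨f s, hpos s hs, fun y hy => hmin hy⟩

/-- An explicitly integrable nonlinearity with the same slope at `c` lying below `f`. -/
lemma exists_exp_lower_bound {f : ℝ → ℝ} (hf : ContDiff ℝ 2 f) {c : ℝ} (hc : f c = 0)
    (hd : 0 < deriv f c) (a b : ℝ) (hac : a ≤ c) (hcb : c ≤ b)
    (hpos : ∀ s ∈ Ioc c b, 0 < f s) :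
    ∃ P > (0 : ℝ), ∀ s ∈ Icc a b, deriv f c * (P * (1 - Real.exp (-((s - c) / P)))) ≤ f s := by
  obtain ⟨K, hK, hquad⟩ := exists_quadratic_lower_bound hf hc a b hac hcb
  set μ := deriv f c with hμ
  have hv0 : 0 < μ / (4 * K) := by positivity
  obtain ⟨m, hm, hmf⟩ := exists_pos_lower_bound hf.continuous (c + μ / (4 * K)) b
    (fun s hs => hpos s ⟨by linarith [hs.1], hs.2⟩)
  set P := min (μ / (4 * K)) (m / μ) with hP
  have hP0 : 0 < P := lt_min hv0 (by positivity)
  have hPK : 4 * K * P ≤ μ := by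
    have := min_le_left (μ / (4 * K)) (m / μ)
    rw [← hP, le_div_iff₀ (by positivity)] at this
    linarith
  have hPm : μ * P ≤ m := by
    have := min_le_right (μ / (4 * K)) (m / μ)
    rw [← hP, le_div_iff₀ hd] at this
    linarith
  refine ⟨P, hP0, fun s hs => ?_⟩
  have hexp := Real.exp_pos (-((s - c) / P))
  by_cases hbig : c + μ / (4 * K) ≤ s
  · refine le_trans ?_ (hmf s ⟨hbig, hs.2⟩)
    have : 0 < μ * P := by positivity
    nlinarith
  · push Not at hbig
    refine le_trans ?_ (hquad s hs)
    obtain ⟨ω, hω⟩ : ∃ ω, s - c = P * ω := ⟨(s - c) / P, by field_simp⟩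
    have hωP : (s - c) / P = ω := by rw [hω]; field_simp
    rw [hωP] at hexp ⊢
    rw [hω]
    have hKω : 4 * K * (P * ω) ≤ μ := by
      have : s - c ≤ μ / (4 * K) := by linarith
      rw [le_div_iff₀ (by positivity), hω] at this
      linarith
    have key : μ * (1 - Real.exp (-ω)) ≤ μ * ω - K * P * ω ^ 2 := by
      rcases le_total ω 2 with h2 | h2
      · have h3 : 1 - ω / 2 ≤ Real.exp (-ω / 2) := by linarith [Real.add_one_le_exp (-ω / 2)]
        have h4 : (1 - ω / 2) ^ 2 ≤ Real.exp (-ω) := by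
          have : Real.exp (-ω) = Real.exp (-ω / 2) ^ 2 := by
            rw [← Real.exp_nat_mul]; congr 1; push_cast; ring
          rw [this]
          exact pow_le_pow_left₀ (by linarith) h3 2
        nlinarith [mul_le_mul_of_nonneg_left h4 hd.le, mul_le_mul_of_nonneg_right hPK (sq_nonneg ω)]
      · have : 4 * (K * P * ω ^ 2) ≤ μ * ω := by nlinarith
        nlinarith [mul_pos hd hexp]
    nlinarith

/-- Time-dependent, spatially homogeneous lower barrier. -/
lemma linear_barrier {N : ℕ} {f φ : ℝ → ℝ} {c : ℝ} (hc : 0 ≤ c)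
    {u : EuclideanSpace ℝ (Fin N) → ℝ → ℝ} (hu : C21 u) (hper : SpacePeriodic u)
    (hpde : ∀ x t, 0 < t → deriv (fun s => u x s) t = lap (fun y => φ (u y t)) x + c * f (u x t))
    (hφ : ContDiff ℝ 2 φ) (hmono : Monotone φ) {b₀ b₁ T m : ℝ} (hb : b₀ ≤ b₁) (hT : 0 < T)
    (hm : ∀ s ∈ Icc b₀ b₁, m ≤ f s) (hfast : (b₁ - b₀) / T < c * m) (h0 : ∀ x, b₀ < u x 0) :
    ∀ x t, 0 ≤ t → t ≤ T → b₀ + (b₁ - b₀) / T * t < u x t := by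
  have key := pos_of_no_first_zero (T := T)
    (F := fun x t => u x t - (b₀ + (b₁ - b₀) / T * t))
    (hu.1.sub (by fun_prop)) (fun x t k => by simp only [hper x t k])
    (fun x => by simpa using h0 x)
    (fun x₀ t₀ ht₀ htT hz hbef => ?_)
  · intro x t ht htT
    linarith [key x t ht htT]
  have hle := le_deriv_of_touch_below (w := fun _ t => b₀ + (b₁ - b₀) / T * t) hu ht₀
    (hpde x₀ t₀ ht₀) hφ hmono (by linarith)
    (Filter.Eventually.of_forall fun y => by linarith [hbef y t₀ ht₀.le le_rfl])
    (by
      filter_upwards [Ioo_mem_nhdsLT ht₀] with t ht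
      linarith [hbef x₀ t ht.1.le ht.2.le])
    (((hasDerivAt_id t₀).const_mul ((b₁ - b₀) / T)).const_add b₀) contDiffAt_const
  have hlap : lap (fun _ : EuclideanSpace ℝ (Fin N) => φ (b₀ + (b₁ - b₀) / T * t₀)) x₀ = 0 := by
    simp [lap, iteratedFDeriv_two_apply]
  rw [hlap] at hle
  have h1 : 0 ≤ (b₁ - b₀) / T := div_nonneg (by linarith) hT.le
  have h2 : (b₁ - b₀) / T * t₀ ≤ b₁ - b₀ := by
    calc (b₁ - b₀) / T * t₀ ≤ (b₁ - b₀) / T * T := by gcongr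
      _ = b₁ - b₀ := by field_simp
  have h3 := hm (b₀ + (b₁ - b₀) / T * t₀) ⟨by nlinarith, by linarith⟩
  have := mul_le_mul_of_nonneg_left h3 hc
  linarith

/-- Lower bound for the Laplacian of a composition. -/
lemma neg_le_lap_comp {N : ℕ} {v : EuclideanSpace ℝ (Fin N) → ℝ} {x : EuclideanSpace ℝ (Fin N)}
    (hv : ContDiff ℝ 2 v) {Ψ Ψ₁ : ℝ → ℝ} {Ψ₂ Λ A₁ A₂ : ℝ}
    (h1 : ∀ᶠ s in nhds (v x), HasDerivAt Ψ (Ψ₁ s) s) (h2 : HasDerivAt Ψ₁ Ψ₂ (v x))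
    (hA₁ : |Ψ₁ (v x)| ≤ A₁) (hA₂ : |Ψ₂| ≤ A₂)
    (hΛ : ∀ i : Fin N, |fderiv ℝ v x (EuclideanSpace.single i 1)| ≤ Λ ∧
      |iteratedFDeriv ℝ 2 v x ![EuclideanSpace.single i 1, EuclideanSpace.single i 1]| ≤ Λ) :
    -(N * (A₂ * Λ ^ 2 + A₁ * Λ)) ≤ lap (fun y => Ψ (v y)) x := by
  have hterm : ∀ i : Fin N, -(A₂ * Λ ^ 2 + A₁ * Λ) ≤ iteratedFDeriv ℝ 2 (fun y => Ψ (v y)) x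
      ![EuclideanSpace.single i 1, EuclideanSpace.single i 1] := fun i => by
    rw [iteratedFDeriv_two_comp_apply hv h1 h2]
    obtain ⟨hp, hq⟩ := hΛ i
    have e1 : |Ψ₂ * (fderiv ℝ v x (EuclideanSpace.single i 1)) ^ 2| ≤ A₂ * Λ ^ 2 := by
      rw [abs_mul, abs_pow]
      gcongr
      exact (abs_nonneg _).trans hA₂
    have e2 : |Ψ₁ (v x) * iteratedFDeriv ℝ 2 v x
        ![EuclideanSpace.single i 1, EuclideanSpace.single i 1]| ≤ A₁ * Λ := by
      rw [abs_mul]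
      gcongr
      exact (abs_nonneg _).trans hA₁
    linarith [(abs_le.1 e1).1, (abs_le.1 e2).1]
  calc -(N * (A₂ * Λ ^ 2 + A₁ * Λ)) = ∑ _i : Fin N, -(A₂ * Λ ^ 2 + A₁ * Λ) := by simp; ring
    _ ≤ lap (fun y => Ψ (v y)) x := Finset.sum_le_sum fun i _ => hterm i

/-- The profile solving `μ z G' = μ P (1 - e^{-(G-α)/P}) (A - e^{(G-α)/P}) / (A - 1)` when
`Q = P (A - 1)`. -/
noncomputable def logProfile (α P Q A z : ℝ) : ℝ :=
  α + P * (Real.log (Q + A * z) - Real.log (Q + z))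

/-- The derivative of `logProfile`. -/
noncomputable def logProfileSlope (Q A z : ℝ) : ℝ := Q ^ 2 / ((Q + A * z) * (Q + z))

section Profile

variable {α P Q A z : ℝ}

lemma lt_of_profile_domain (hA : 1 < A) (hz : 0 < Q + A * z) :
    Q * (1 - A⁻¹) < Q + z := by
  have hA0 : 0 < A := by linarith
  have : A * (Q * (1 - A⁻¹)) < A * (Q + z) := by
    have : A * (Q * (1 - A⁻¹)) = A * Q - Q := by field_simp
    nlinarith
  exact lt_of_mul_lt_mul_left this hA0.le

lemma pos_of_profile_domain (hA : 1 < A) (hQ : 0 < Q) (hz : 0 < Q + A * z) : 0 < Q + z := by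
  have := lt_of_profile_domain hA hz
  have h1 : A⁻¹ < 1 := inv_lt_one_of_one_lt₀ hA
  nlinarith

lemma hasDerivAt_logProfile (hQP : Q = P * (A - 1)) (hz : 0 < Q + A * z) (hz' : 0 < Q + z) :
    HasDerivAt (logProfile α P Q A) (logProfileSlope Q A z) z := by
  have h1 : HasDerivAt (fun z => Real.log (Q + A * z)) (A * 1 / (Q + A * z)) z :=
    (((hasDerivAt_id z).const_mul A).const_add Q).log hz.ne'
  have h2 : HasDerivAt (fun z => Real.log (Q + z)) (1 / (Q + z)) z :=
    ((hasDerivAt_id z).const_add Q).log hz'.ne'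
  have h : HasDerivAt (logProfile α P Q A) _ z := ((h1.sub h2).const_mul P).const_add α
  refine h.congr_deriv ?_
  unfold logProfileSlope
  have e : P * (A * 1 / (Q + A * z) - 1 / (Q + z)) =
      Q * (P * (A - 1)) / ((Q + A * z) * (Q + z)) := by
    field_simp
    ring
  rw [e, ← hQP, sq]

lemma hasDerivAt_logProfileSlope (hz : 0 < Q + A * z) (hz' : 0 < Q + z) :
    HasDerivAt (logProfileSlope Q A)
      (-(logProfileSlope Q A z * (A / (Q + A * z) + 1 / (Q + z)))) z := by
  have h1 : HasDerivAt (fun z => Q + A * z) (A * 1) z :=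
    ((hasDerivAt_id z).const_mul A).const_add Q
  have h2 : HasDerivAt (fun z => Q + z) 1 z := (hasDerivAt_id z).const_add Q
  have h : HasDerivAt (logProfileSlope Q A) _ z :=
    (hasDerivAt_const z (Q ^ 2)).div (h1.mul h2) (mul_pos hz hz').ne'
  refine h.congr_deriv ?_
  unfold logProfileSlope
  field_simp
  ring

lemma exp_logProfile (hP : 0 < P) (hz : 0 < Q + A * z) (hz' : 0 < Q + z) :
    Real.exp ((logProfile α P Q A z - α) / P) * (Q + z) = Q + A * z := by
  have : (logProfile α P Q A z - α) / P = Real.log (Q + A * z) - Real.log (Q + z) := by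
    unfold logProfile
    field_simp
    ring
  rw [this, Real.exp_sub, Real.exp_log hz, Real.exp_log hz']
  field_simp

lemma logProfile_le_iff (hP : 0 < P) (hz : 0 < Q + A * z) (hz' : 0 < Q + z) (y : ℝ) :
    logProfile α P Q A z ≤ y ↔ Q + A * z ≤ Real.exp ((y - α) / P) * (Q + z) := by
  rw [← exp_logProfile (α := α) hP hz hz', mul_le_mul_iff_left₀ hz', Real.exp_le_exp,
    div_le_div_iff_of_pos_right hP, sub_le_sub_iff_right]

lemma le_logProfile_iff (hP : 0 < P) (hz : 0 < Q + A * z) (hz' : 0 < Q + z) (y : ℝ) :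
    y ≤ logProfile α P Q A z ↔ Real.exp ((y - α) / P) * (Q + z) ≤ Q + A * z := by
  rw [← exp_logProfile (α := α) hP hz hz', mul_le_mul_iff_left₀ hz', Real.exp_le_exp,
    div_le_div_iff_of_pos_right hP, sub_le_sub_iff_right]

lemma logProfile_le (hP : 0 < P) (hA : 1 < A) (hQ : 0 < Q) (hz : 0 < Q + A * z) :
    logProfile α P Q A z ≤ α + P * Real.log A := by
  have hz' := pos_of_profile_domain hA hQ hz
  rw [logProfile_le_iff hP hz hz']
  have : (α + P * Real.log A - α) / P = Real.log A := by field_simp; ring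
  rw [this, Real.exp_log (by linarith)]
  nlinarith

/-- The profile is a subsolution of the ordinary differential equation `μ z G' = f(G)`. -/
lemma mul_logProfileSlope_le (hP : 0 < P) (hA : 1 < A) (hQ : 0 < Q) (hQP : Q = P * (A - 1))
    (hz : 0 < Q + A * z) :
    z * logProfileSlope Q A z ≤ P * (1 - Real.exp (-((logProfile α P Q A z - α) / P))) := by
  have hz' := pos_of_profile_domain hA hQ hz
  have hE := exp_logProfile (α := α) hP hz hz'
  rw [Real.exp_neg, eq_div_of_mul_eq hz'.ne' hE, inv_div]
  have e : P * (1 - (Q + z) / (Q + A * z)) = P * (A - 1) * z / (Q + A * z) := by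
    rw [one_sub_div hz.ne', mul_div_assoc']
    congr 1
    ring
  rw [e, ← hQP]
  unfold logProfileSlope
  rw [← mul_div_assoc, div_le_div_iff₀ (mul_pos hz hz') hz]
  nlinarith [mul_nonneg (mul_nonneg hQ.le (sq_nonneg z)) (sq_nonneg (Q + A * z)),
    mul_nonneg (mul_nonneg hQ.le (sq_nonneg z)) hz.le]

/-- Above a fixed level the profile has bounded slope and bounded logarithmic curvature. -/
lemma exists_logProfile_bound (hP : 0 < P) (hA : 1 < A) (hQ : 0 < Q) (B : ℝ) :
    ∃ C > (0 : ℝ), ∀ z, 0 < Q + A * z → B ≤ logProfile α P Q A z →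
      logProfileSlope Q A z ≤ C ∧ A / (Q + A * z) + 1 / (Q + z) ≤ C := by
  have hA0 : 0 < A := by linarith
  set q := Q * (1 - A⁻¹) with hq
  set X := Real.exp ((B - α) / P) with hX
  have hX0 : 0 < X := Real.exp_pos _
  have hq0 : 0 < q := mul_pos hQ (by linarith [inv_lt_one_of_one_lt₀ hA])
  refine ⟨Q ^ 2 / (X * q * q) + (A / (X * q) + 1 / q), by positivity, fun z hz hB => ?_⟩
  have hzq : q < Q + z := lt_of_profile_domain hA hz
  have hz' : 0 < Q + z := hq0.trans hzq
  rw [le_logProfile_iff hP hz hz'] at hB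
  have hXz : X * q ≤ Q + A * z := le_trans (by gcongr) hB
  have h1 : logProfileSlope Q A z ≤ Q ^ 2 / (X * q * q) := by
    unfold logProfileSlope
    gcongr
  have h2 : A / (Q + A * z) ≤ A / (X * q) := by gcongr
  have h3 : 1 / (Q + z) ≤ 1 / q := by gcongr
  have h4 : 0 ≤ A / (X * q) + 1 / q := by positivity
  have h5 : 0 ≤ Q ^ 2 / (X * q * q) := by positivity
  exact ⟨by linarith, by linarith⟩

end Profile

/-- The logarithmic-profile subsolution stays below the solution. -/
lemma logProfile_barrier {N : ℕ} {f φ : ℝ → ℝ} {k μ α P Q A B C₁ cG Λ K T : ℝ} (hk : 0 < k)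
    (hμ : 0 < μ) (hP : 0 < P) (hA : 1 < A) (hQP : Q = P * (A - 1))
    {u : EuclideanSpace ℝ (Fin N) → ℝ → ℝ} (hu : C21 u) (hper : SpacePeriodic u)
    (hpde : ∀ x t, 0 < t → deriv (fun s => u x s) t = lap (fun y => φ (u y t)) x + k * f (u x t))
    (hφ : ContDiff ℝ 2 φ) (hmono : Monotone φ)
    (hΛ : ∀ x, ∀ i : Fin N, |fderiv ℝ (fun y => u y 0) x (EuclideanSpace.single i 1)| ≤ Λ ∧
      |iteratedFDeriv ℝ 2 (fun y => u y 0) x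
        ![EuclideanSpace.single i 1, EuclideanSpace.single i 1]| ≤ Λ)
    (hB : ∀ x t, 0 ≤ t → t ≤ T → B ≤ u x t)
    (hf : ∀ s ∈ Icc B (α + P * Real.log A),
      μ * (P * (1 - Real.exp (-((s - α) / P)))) ≤ f s)
    (hC₁ : ∀ s ∈ Icc B (α + P * Real.log A), |deriv φ s| ≤ C₁ ∧ |deriv (deriv φ) s| ≤ C₁)
    (hcG : ∀ z, 0 < Q + A * z → B ≤ logProfile α P Q A z →
      logProfileSlope Q A z ≤ cG ∧ A / (Q + A * z) + 1 / (Q + z) ≤ cG)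
    (hK0 : 0 < K) (hK : N * (2 * C₁ * cG * Λ ^ 2 + C₁ * Λ) < μ * K) :
    ∀ x t, 0 ≤ t → t ≤ T → ∀ z,
      z = Real.exp (μ * k * t) * (u x 0 - α) - K / k * Real.exp (μ * k * t) ^ 2 →
      0 < Q + A * z → logProfile α P Q A z < u x t := by
  have hA0 : 0 < A := by linarith
  have hQ : 0 < Q := by rw [hQP]; exact mul_pos hP (by linarith)
  set Z : EuclideanSpace ℝ (Fin N) → ℝ → ℝ := fun x t =>
    Real.exp (μ * k * t) * (u x 0 - α) - K / k * Real.exp (μ * k * t) ^ 2 with hZ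
  have hu0c : ContDiff ℝ 2 (fun y => u y 0) := hu.2.1 0 le_rfl
  have hZc : Continuous fun p : EuclideanSpace ℝ (Fin N) × ℝ => Z p.1 p.2 := by
    have := hu0c.continuous.comp (continuous_fst (X := EuclideanSpace ℝ (Fin N)) (Y := ℝ))
    simp only [Function.comp_def] at this
    simp only [hZ]
    fun_prop
  set F : EuclideanSpace ℝ (Fin N) → ℝ → ℝ := fun x t =>
    Real.exp ((u x t - α) / P) * (Q + max (Z x t) (-Q / A)) - (Q + A * max (Z x t) (-Q / A))
    with hF
  have hQA : Q + A * (-Q / A) = 0 := by field_simp; ring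
  have hQA' : 0 < Q + -Q / A := by
    have : Q / A < Q := div_lt_self hQ hA
    rw [neg_div]; linarith
  have hFlow : ∀ x t, Q + A * Z x t ≤ 0 → 0 < F x t := fun x t h => by
    have : Z x t ≤ -Q / A := by rw [le_div_iff₀ hA0]; linarith
    simp only [hF, max_eq_right this, hQA, sub_zero]
    positivity
  have hFhigh : ∀ x t, 0 < Q + A * Z x t →
      F x t = Real.exp ((u x t - α) / P) * (Q + Z x t) - (Q + A * Z x t) := fun x t h => by
    have : -Q / A ≤ Z x t := by rw [div_le_iff₀ hA0]; linarith
    simp only [hF, max_eq_left this]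
  have hle_iff : ∀ x t, 0 < Q + A * Z x t →
      (0 ≤ F x t ↔ logProfile α P Q A (Z x t) ≤ u x t) := fun x t h => by
    rw [hFhigh x t h, logProfile_le_iff hP h (pos_of_profile_domain hA hQ h), sub_nonneg]
  have hge_iff : ∀ x t, 0 < Q + A * Z x t →
      (F x t ≤ 0 ↔ u x t ≤ logProfile α P Q A (Z x t)) := fun x t h => by
    rw [hFhigh x t h, le_logProfile_iff hP h (pos_of_profile_domain hA hQ h), sub_nonpos]
  have hpos := pos_of_no_first_zero (T := T) (F := F)
    (by
      have := hu.1
      simp only [hF]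
      fun_prop)
    (fun x t j => by simp only [hF, hZ, hper x t j, hper x 0 j])
    (fun x => by
      rcases le_or_gt (Q + A * Z x 0) 0 with h | h
      · exact hFlow x 0 h
      · rw [hFhigh x 0 h]
        have hz' := pos_of_profile_domain hA hQ h
        have hlt : Z x 0 < u x 0 - α := by
          simp only [hZ, mul_zero, Real.exp_zero, one_mul, one_pow, mul_one]
          have : 0 < K / k := by positivity
          linarith
        have h1 : 1 + Z x 0 / P < Real.exp ((u x 0 - α) / P) := by
          have h2 : (u x 0 - α) / P + 1 ≤ Real.exp ((u x 0 - α) / P) := Real.add_one_le_exp _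
          have h3 : Z x 0 / P < (u x 0 - α) / P := by gcongr
          linarith
        have h4 : (1 + Z x 0 / P) * (Q + Z x 0) = Q + A * Z x 0 + Z x 0 ^ 2 / P := by
          rw [hQP]; field_simp; ring
        have h5 : 0 ≤ Z x 0 ^ 2 / P := by positivity
        nlinarith [mul_lt_mul_of_pos_right h1 hz'])
    (fun x₀ t₀ ht₀ htT hz hbef => ?_)
  · intro x t ht htT z hz hdom
    subst hz
    by_contra! hcon
    exact absurd (hpos x t ht htT) (not_lt.2 ((hge_iff x t hdom).2 hcon))
  have hdom : 0 < Q + A * Z x₀ t₀ := by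
    by_contra! h
    exact (hFlow x₀ t₀ h).ne' hz
  have hdom' := pos_of_profile_domain hA hQ hdom
  have heq : logProfile α P Q A (Z x₀ t₀) = u x₀ t₀ :=
    le_antisymm ((hle_iff _ _ hdom).1 hz.ge) ((hge_iff _ _ hdom).1 hz.le)
  set a := Real.exp (μ * k * t₀) with ha
  have ha1 : 1 ≤ a := Real.one_le_exp (by positivity)
  set z₀ := Z x₀ t₀ with hz₀
  have hBz : B ≤ logProfile α P Q A z₀ := by rw [heq]; exact hB x₀ t₀ ht₀.le htT
  have hmem : logProfile α P Q A z₀ ∈ Icc B (α + P * Real.log A) :=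
    ⟨hBz, logProfile_le hP hA hQ hdom⟩
  obtain ⟨hs1, hs2⟩ := hcG z₀ hdom hBz
  obtain ⟨hφ1, hφ2⟩ := hC₁ _ hmem
  have hslope0 : 0 < logProfileSlope Q A z₀ := by unfold logProfileSlope; positivity
  set σ := logProfileSlope Q A z₀ with hσ
  set r := A / (Q + A * z₀) + 1 / (Q + z₀) with hr
  have hr0 : 0 < r := by positivity
  have hZx : Continuous fun y => Z y t₀ := hZc.comp (by fun_prop : Continuous fun y => (y, t₀))
  have hZt : Continuous fun t => Z x₀ t := hZc.comp (by fun_prop : Continuous fun t => (x₀, t))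
  -- time derivative of the profile
  have hZd : HasDerivAt (fun t => Z x₀ t) (μ * k * z₀ - μ * K * a ^ 2) t₀ := by
    have he : HasDerivAt (fun t => Real.exp (μ * k * t)) (a * (μ * k * 1)) t₀ :=
      ((hasDerivAt_id t₀).const_mul (μ * k)).exp
    have h := (he.mul_const (u x₀ 0 - α)).sub ((he.pow 2).const_mul (K / k))
    refine h.congr_deriv ?_
    simp only [hz₀, hZ, ← ha]
    field_simp
    ring
  have hwd : HasDerivAt (fun t => logProfile α P Q A (Z x₀ t))
      (σ * (μ * k * z₀ - μ * K * a ^ 2)) t₀ := by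
    have hg : HasDerivAt (logProfile α P Q A) σ (Z x₀ t₀) := hasDerivAt_logProfile hQP hdom hdom'
    exact HasDerivAt.comp (h₂ := logProfile α P Q A) (h := fun t => Z x₀ t) t₀ hg hZd
  -- composition with the initial datum in space
  set ζ : ℝ → ℝ := fun s => a * (s - α) - K / k * a ^ 2 with hζ
  have hζ0 : ζ (u x₀ 0) = z₀ := rfl
  have hζd : ∀ s, HasDerivAt ζ a s := fun s => by
    have := (((hasDerivAt_id s).sub_const α).const_mul a).sub_const (K / k * a ^ 2)
    rwa [mul_one] at this
  have hφd : ∀ s, HasDerivAt φ (deriv φ s) s := fun s =>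
    (hφ.differentiable (by norm_num) s).hasDerivAt
  have hφ1c : ContDiff ℝ 1 (deriv φ) := by
    have : ContDiff ℝ (1 + 1) φ := by simpa [one_add_one_eq_two] using hφ
    exact (contDiff_succ_iff_deriv.1 this).2.2
  have hφd2 : ∀ s, HasDerivAt (deriv φ) (deriv (deriv φ) s) s := fun s =>
    (hφ1c.differentiable (by norm_num) s).hasDerivAt
  have hζev : ∀ᶠ s in nhds (u x₀ 0), 0 < Q + A * ζ s := by
    have : ContinuousAt (fun s => Q + A * ζ s) (u x₀ 0) := by
      have := (hζd (u x₀ 0)).continuousAt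
      fun_prop
    exact this.eventually (lt_mem_nhds hdom)
  have hΨ1 : ∀ᶠ s in nhds (u x₀ 0), HasDerivAt (fun s => φ (logProfile α P Q A (ζ s)))
      (deriv φ (logProfile α P Q A (ζ s)) * (logProfileSlope Q A (ζ s) * a)) s := by
    filter_upwards [hζev] with s hs
    exact (hφd _).comp s ((hasDerivAt_logProfile hQP hs (pos_of_profile_domain hA hQ hs)).comp s
      (hζd s))
  have hΨ2 : HasDerivAt
      (fun s => deriv φ (logProfile α P Q A (ζ s)) * (logProfileSlope Q A (ζ s) * a))
      (deriv (deriv φ) (logProfile α P Q A z₀) * (σ * a) * (σ * a) +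
        deriv φ (logProfile α P Q A z₀) * (-(σ * r) * a * a)) (u x₀ 0) := by
    have h1 := (hasDerivAt_logProfile (α := α) hQP hdom hdom').comp (u x₀ 0) (hζd (u x₀ 0))
    have h2 := (hφd2 (logProfile α P Q A z₀)).comp (u x₀ 0) h1
    have h3 := ((hasDerivAt_logProfileSlope hdom hdom').comp (u x₀ 0)
      (hζd (u x₀ 0))).mul_const a
    exact h2.mul h3
  have hw2 : ContDiffAt ℝ 2 (fun y => φ (logProfile α P Q A (Z y t₀))) x₀ := by
    have hZC : ContDiffAt ℝ 2 (fun y => Z y t₀) x₀ :=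
      ((contDiff_const.mul (hu0c.sub contDiff_const)).sub contDiff_const).contDiffAt
    have hG : ContDiffAt ℝ 2 (fun y => logProfile α P Q A (Z y t₀)) x₀ := by
      have e1 : ContDiffAt ℝ 2 (fun y => Real.log (Q + A * Z y t₀)) x₀ :=
        (contDiffAt_const.add (contDiffAt_const.mul hZC)).log hdom.ne'
      have e2 : ContDiffAt ℝ 2 (fun y => Real.log (Q + Z y t₀)) x₀ :=
        (contDiffAt_const.add hZC).log hdom'.ne'
      exact contDiffAt_const.add (contDiffAt_const.mul (e1.sub e2))
    exact hφ.contDiffAt.comp x₀ hG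
  have hle := le_deriv_of_touch_below (w := fun x t => logProfile α P Q A (Z x t)) hu ht₀
    (hpde x₀ t₀ ht₀) hφ hmono heq
    (by
      have : ∀ᶠ y in nhds x₀, 0 < Q + A * Z y t₀ :=
        (show Continuous fun y => Q + A * Z y t₀ by fun_prop).continuousAt.eventually
          (lt_mem_nhds hdom)
      filter_upwards [this] with y hy
      exact (hle_iff y t₀ hy).1 (hbef y t₀ ht₀.le le_rfl))
    (by
      have : ∀ᶠ t in nhds t₀, 0 < Q + A * Z x₀ t :=
        (show Continuous fun t => Q + A * Z x₀ t by fun_prop).continuousAt.eventually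
          (lt_mem_nhds hdom)
      filter_upwards [nhdsWithin_le_nhds this, Ioo_mem_nhdsLT ht₀] with t h1 h2
      exact (hle_iff x₀ t h1).1 (hbef x₀ t h2.1.le h2.2.le))
    hwd hw2
  have hC0 : 0 ≤ C₁ := (abs_nonneg _).trans hφ1
  have hcG0 : 0 ≤ cG := hslope0.le.trans hs1
  have hA₁ : |deriv φ (logProfile α P Q A z₀) * (σ * a)| ≤ C₁ * (σ * a ^ 2) := by
    rw [abs_mul, abs_of_pos (by positivity : 0 < σ * a)]
    gcongr
    nlinarith
  have hA₂ : |deriv (deriv φ) (logProfile α P Q A z₀) * (σ * a) * (σ * a) +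
        deriv φ (logProfile α P Q A z₀) * (-(σ * r) * a * a)| ≤
        2 * C₁ * cG * (σ * a ^ 2) := by
    have e1 : |deriv (deriv φ) (logProfile α P Q A z₀) * (σ * a) * (σ * a)| ≤
        C₁ * (cG * a) * (σ * a) := by
      rw [abs_mul, abs_mul, abs_of_pos (by positivity : 0 < σ * a)]
      gcongr
    have e2 : |deriv φ (logProfile α P Q A z₀) * (-(σ * r) * a * a)| ≤
        C₁ * (σ * cG * a * a) := by
      rw [abs_mul, show -(σ * r) * a * a = -(σ * r * a * a) by ring, abs_neg,
        abs_of_pos (by positivity : 0 < σ * r * a * a)]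
      gcongr
    calc _ ≤ _ := abs_add_le _ _
      _ ≤ C₁ * (cG * a) * (σ * a) + C₁ * (σ * cG * a * a) := add_le_add e1 e2
      _ = _ := by ring
  have hlap := neg_le_lap_comp (v := fun y => u y 0) hu0c hΨ1 hΨ2 hA₁ hA₂ (hΛ x₀)
  change -(N * (2 * C₁ * cG * (σ * a ^ 2) * Λ ^ 2 + C₁ * (σ * a ^ 2) * Λ)) ≤
    lap (fun y => φ (logProfile α P Q A (Z y t₀))) x₀ at hlap
  have hreact : μ * (z₀ * σ) ≤ f (logProfile α P Q A z₀) :=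
    (mul_le_mul_of_nonneg_left (mul_logProfileSlope_le hP hA hQ hQP hdom) hμ.le).trans
      (hf _ hmem)
  have hreact' := mul_le_mul_of_nonneg_left hreact hk.le
  have hfin := mul_lt_mul_of_pos_right hK (by positivity : 0 < σ * a ^ 2)
  linarith

/-- Lower half of the generation of the interface. -/
lemma generation_lower {N : ℕ} {f φ : ℝ → ℝ} {αm αc αp : ℝ}
    (hf : ContDiff ℝ 2 f) (hmc : αm < αc) (hfc0 : f αc = 0)
    (hne : ∀ s ∈ Ioo αc αp, f s ≠ 0) (hfc : 0 < deriv f αc)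
    (hfbelow : ∀ s, s < αm → 0 < f s)
    (hφ : ContDiff ℝ 2 φ) (hmono : Monotone φ)
    {u0 : EuclideanSpace ℝ (Fin N) → ℝ}
    (hu0 : ContDiff ℝ 2 u0) (hu0per : SpacePeriodicFn u0)
    {η : ℝ} (hη0 : 0 < η) (hη1 : η < αp - αc) :
    ∃ ε₀ > (0 : ℝ), ∃ M₀ > (0 : ℝ), ∀ ε : ℝ, 0 < ε → ε < ε₀ →
      ∀ u : EuclideanSpace ℝ (Fin N) → ℝ → ℝ, SpacePeriodic u → C21 u →
        (∀ x t, 0 < t → deriv (fun s => u x s) t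
          = lap (fun y => φ (u y t)) x + (1 / ε ^ 2) * f (u x t)) →
        (∀ x, u x 0 = u0 x) →
        (∀ x, αm - η ≤ u x ((deriv f αc)⁻¹ * ε ^ 2 * |Real.log ε|)) ∧
        (∀ x, αc + M₀ * ε ≤ u0 x →
          αp - η ≤ u x ((deriv f αc)⁻¹ * ε ^ 2 * |Real.log ε|)) := by
  set μ := deriv f αc with hμ
  obtain ⟨Λ, hΛ0, hΛ⟩ := hu0per.exists_bound hu0
  set B := min (-Λ - 1) (αm - η - 1) with hB
  have hBΛ : B ≤ -Λ - 1 := min_le_left _ _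
  have hBm : B ≤ αm - η - 1 := min_le_right _ _
  obtain ⟨m, hm, hmf⟩ := exists_pos_lower_bound hf.continuous B (αm - η)
    (fun s hs => hfbelow s (by linarith [hs.2]))
  have hfpos := pos_on_Ioo_of_deriv_pos hf.continuous hfc0 hfc hne
  set b := αp - η / 2 with hb
  obtain ⟨P, hP, hfP⟩ := exists_exp_lower_bound hf hfc0 hfc B b (by linarith) (by linarith)
    (fun s hs => hfpos s ⟨hs.1, by linarith [hs.2]⟩)
  set A := Real.exp ((b - αc) / P) with hA
  have hA1 : 1 < A := by
    rw [hA, Real.one_lt_exp_iff]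
    exact div_pos (by linarith) hP
  have hA0 : 0 < A := by linarith
  have hbA : αc + P * Real.log A = b := by
    rw [hA, Real.log_exp]; field_simp; ring
  set Q := P * (A - 1) with hQ
  have hQ0 : 0 < Q := mul_pos hP (by linarith)
  obtain ⟨cG, hcG0, hcG⟩ := exists_logProfile_bound (α := αc) hP hA1 hQ0 B
  have hφ1c : ContDiff ℝ 1 (deriv φ) := by
    have : ContDiff ℝ (1 + 1) φ := by simpa [one_add_one_eq_two] using hφ
    exact (contDiff_succ_iff_deriv.1 this).2.2
  obtain ⟨Ca, hCa⟩ := isCompact_Icc.exists_bound_of_continuousOn (s := Icc B b)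
    hφ1c.continuous.continuousOn
  obtain ⟨Cb, hCb⟩ := isCompact_Icc.exists_bound_of_continuousOn (s := Icc B b)
    (hφ1c.continuous_deriv le_rfl).continuousOn
  set C₁ := |Ca| + |Cb| with hC₁
  have hCφ : ∀ s ∈ Icc B b, |deriv φ s| ≤ C₁ ∧ |deriv (deriv φ) s| ≤ C₁ := fun s hs =>
    ⟨(hCa s hs).trans ((le_abs_self Ca).trans (le_add_of_nonneg_right (abs_nonneg Cb))),
      (hCb s hs).trans ((le_abs_self Cb).trans (le_add_of_nonneg_left (abs_nonneg Ca)))⟩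
  set K := N * (2 * C₁ * cG * Λ ^ 2 + C₁ * Λ) / μ + 1 with hK
  have hK0 : 0 < K := by positivity
  have hKμ : N * (2 * C₁ * cG * Λ ^ 2 + C₁ * Λ) < μ * K := by
    have : μ * K = N * (2 * C₁ * cG * Λ ^ 2 + C₁ * Λ) + μ := by
      rw [hK]; field_simp
    linarith
  set θ := Real.exp (-(η / 2) / P) with hθ
  have hθ0 : 0 < θ := Real.exp_pos _
  have hθ1 : θ < 1 := by
    rw [hθ, Real.exp_lt_one_iff]
    exact div_neg_of_neg_of_pos (by linarith) hP
  have hM1 : 0 < Q / (1 - θ) := div_pos hQ0 (by linarith)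
  set S := αm - η - B with hS
  have hS0 : 0 < S := by linarith
  refine ⟨Real.exp (-(S * μ / m)), Real.exp_pos _, K + Q / (1 - θ), by positivity, ?_⟩
  intro ε hε0 hε u huper hu hpde hinit
  have hlog : Real.log ε < -(S * μ / m) := (Real.log_lt_iff_lt_exp hε0).2 hε
  have hSm : 0 < S * μ / m := by positivity
  set T := μ⁻¹ * ε ^ 2 * |Real.log ε| with hT
  have habs : |Real.log ε| = -Real.log ε := abs_of_neg (by linarith)
  have hL : 0 < |Real.log ε| := by rw [habs]; linarith
  have hT0 : 0 < T := by positivity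
  have hk : 0 < 1 / ε ^ 2 := by positivity
  have hinit' : (fun y => u y 0) = u0 := funext hinit
  have hlin := linear_barrier (b₀ := B) (b₁ := αm - η) (m := m) hk.le hu huper hpde hφ hmono
    (by linarith) hT0 hmf
    (by
      rw [div_lt_iff₀ hT0]
      have e : 1 / ε ^ 2 * m * T = m * |Real.log ε| / μ := by
        rw [hT]; field_simp
      rw [e, lt_div_iff₀ hfc, habs]
      have : S * μ / m < -Real.log ε := by linarith
      rw [div_lt_iff₀ hm] at this
      linarith)
    (fun x => by rw [hinit x]; linarith [(abs_le.1 (hΛ x).1).1])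
  refine ⟨fun x => ?_, fun x hx => ?_⟩
  · have h := hlin x T hT0.le le_rfl
    rw [div_mul_cancel₀ _ hT0.ne'] at h
    linarith
  have hbar := logProfile_barrier (B := B) (T := T) hk hfc hP hA1 hQ hu huper hpde hφ hmono
    (by rw [hinit']; exact fun x => (hΛ x).2)
    (fun x t ht htT => by
      have h1 := hlin x t ht htT
      have h2 : 0 ≤ (αm - η - B) / T * t := mul_nonneg (div_nonneg hS0.le hT0.le) ht
      linarith)
    (by rw [hbA]; exact hfP)
    (by rw [hbA]; exact hCφ)
    hcG hK0 hKμ x T hT0.le le_rfl ((u0 x - αc) / ε - K)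
    (by
      have e : Real.exp (μ * (1 / ε ^ 2) * T) = ε⁻¹ := by
        have : μ * (1 / ε ^ 2) * T = -Real.log ε := by
          rw [hT, habs]; field_simp
        rw [this, Real.exp_neg, Real.exp_log hε0]
      rw [e, hinit x]
      field_simp)
  have hz : Q / (1 - θ) ≤ (u0 x - αc) / ε - K := by
    have : K + Q / (1 - θ) ≤ (u0 x - αc) / ε := by
      rw [le_div_iff₀ hε0]; linarith
    linarith
  set z := (u0 x - αc) / ε - K with hzdef
  have hz0 : 0 < z := hM1.trans_le hz
  have hdom : 0 < Q + A * z := by positivity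
  have hdom' : 0 < Q + z := by positivity
  refine le_trans ?_ (hbar hdom).le
  rw [le_logProfile_iff hP hdom hdom']
  have e : Real.exp ((αp - η - αc) / P) = A * θ := by
    rw [hA, hθ, ← Real.exp_add]
    congr 1
    rw [hb]
    ring
  rw [e]
  rw [div_le_iff₀ (by linarith)] at hz
  nlinarith [mul_le_mul_of_nonneg_left hz hA0.le, mul_pos hA0 hQ0, mul_pos (mul_pos hA0 hQ0) hθ0,
    mul_pos (mul_pos hA0 hQ0) (sub_pos.2 hθ1)]

lemma lap_neg {N : ℕ} (g : EuclideanSpace ℝ (Fin N) → ℝ) (x : EuclideanSpace ℝ (Fin N)) :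
    lap (fun y => -g y) x = -lap g x := by
  have : iteratedFDeriv ℝ 2 (fun y => -g y) x = -iteratedFDeriv ℝ 2 g x :=
    iteratedFDeriv_neg_apply
  simp [lap, this]

/-- Generation of the interface in the periodic setting.
At time `t^ε = μ⁻¹ ε² |log ε|` the solution has essentially reached the stable
states `α_±` away from the `α`-level set of the initial datum. -/
theorem generation_of_interface_periodic
    (N : ℕ) (hN : 2 ≤ N)
    (f : ℝ → ℝ) (αm αc αp : ℝ)
    (hf : ContDiff ℝ 2 f)
    (hαs : αm < αc ∧ αc < αp)
    (hzeros : ∀ s : ℝ, f s = 0 ↔ s = αm ∨ s = αc ∨ s = αp)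
    (hfm : deriv f αm < 0) (hfp : deriv f αp < 0) (hfc : 0 < deriv f αc)
    (hfbelow : ∀ s : ℝ, s < αm → 0 < f s) (hfabove : ∀ s : ℝ, αp < s → f s < 0)
    (φ : ℝ → ℝ) (Cφ : ℝ) (hCφ : 0 < Cφ)
    (hφ : ContDiff ℝ 4 φ) (hφ' : ∀ s : ℝ, Cφ ≤ deriv φ s)
    (u0 : EuclideanSpace ℝ (Fin N) → ℝ)
    (hu0 : ContDiff ℝ 2 u0) (hu0per : SpacePeriodicFn u0)
    (η : ℝ) (hη0 : 0 < η) (hη1 : η < min (αc - αm) (αp - αc)) :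
    ∃ ε₀ > (0 : ℝ), ∃ M₀ > (0 : ℝ),
      ∀ ε : ℝ, 0 < ε → ε < ε₀ →
        ∀ uε : EuclideanSpace ℝ (Fin N) → ℝ → ℝ,
          SpacePeriodic uε → C21 uε →
          (∀ (x : EuclideanSpace ℝ (Fin N)) (t : ℝ), 0 < t →
            deriv (fun s => uε x s) t
              = lap (fun y => φ (uε y t)) x + (1 / ε ^ 2) * f (uε x t)) →
          (∀ x : EuclideanSpace ℝ (Fin N), uε x 0 = u0 x) →
          (∀ x : EuclideanSpace ℝ (Fin N),
              αm - η ≤ uε x ((deriv f αc)⁻¹ * ε ^ 2 * |Real.log ε|) ∧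
              uε x ((deriv f αc)⁻¹ * ε ^ 2 * |Real.log ε|) ≤ αp + η) ∧
          (∀ x : EuclideanSpace ℝ (Fin N), αc + M₀ * ε ≤ u0 x →
              αp - η ≤ uε x ((deriv f αc)⁻¹ * ε ^ 2 * |Real.log ε|)) ∧
          (∀ x : EuclideanSpace ℝ (Fin N), u0 x ≤ αc - M₀ * ε →
              uε x ((deriv f αc)⁻¹ * ε ^ 2 * |Real.log ε|) ≤ αm + η) := by
  have hfc0 : f αc = 0 := (hzeros αc).2 (Or.inr (Or.inl rfl))
  have hmono : Monotone φ := monotone_of_deriv_nonneg (hφ.differentiable (by norm_num))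
    fun s => hCφ.le.trans (hφ' s)
  have hφ2 : ContDiff ℝ 2 φ := hφ.of_le (by norm_num)
  have hηm : η < αc - αm := hη1.trans_le (min_le_left _ _)
  have hηp : η < αp - αc := hη1.trans_le (min_le_right _ _)
  obtain ⟨ε₁, hε₁, M₁, hM₁, h₁⟩ := generation_lower hf hαs.1 hfc0
    (fun s hs h => by
      rcases (hzeros s).1 h with h | h | h
      · linarith [hs.1, hαs.1]
      · linarith [hs.1]
      · linarith [hs.2]) hfc hfbelow hφ2 hmono hu0 hu0per hη0 hηp
  have hd : deriv (fun s => -f (-s)) (-αc) = deriv f αc := by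
    rw [deriv.fun_neg, deriv_comp_neg (f := f)]
    simp
  obtain ⟨ε₂, hε₂, M₂, hM₂, h₂⟩ := generation_lower (f := fun s => -f (-s))
    (φ := fun s => -φ (-s)) (αm := -αp) (αc := -αc) (αp := -αm) (u0 := fun x => -u0 x) (η := η)
    (hf.comp contDiff_neg).neg (by linarith) (by simp [hfc0])
    (fun s hs h => by
      have hs1 := hs.1
      have hs2 := hs.2
      rcases (hzeros (-s)).1 (by linarith) with h | h | h <;> linarith)
    (by rw [hd]; exact hfc)
    (fun s hs => by linarith [hfabove (-s) (by linarith)])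
    (hφ2.comp contDiff_neg).neg (fun s t h => neg_le_neg (hmono (neg_le_neg h)))
    hu0.neg (fun x k => congrArg Neg.neg (hu0per x k)) hη0 (by linarith)
  rw [hd] at h₂
  refine ⟨min ε₁ ε₂, lt_min hε₁ hε₂, max M₁ M₂, lt_max_of_lt_left hM₁, ?_⟩
  intro ε hε hεlt u huper hu hpde hinit
  obtain ⟨a1, a2⟩ := h₁ ε hε (hεlt.trans_le (min_le_left _ _)) u huper hu hpde hinit
  obtain ⟨b1, b2⟩ := h₂ ε hε (hεlt.trans_le (min_le_right _ _)) (fun x t => -u x t)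
    (fun x t k => congrArg Neg.neg (huper x t k))
    ⟨hu.1.neg, fun t ht => (hu.2.1 t ht).neg, fun x => (hu.2.2 x).neg⟩
    (fun x t ht => by
      rw [deriv.fun_neg, hpde x t ht]
      simp only [neg_neg]
      rw [lap_neg]
      ring)
    (fun x => congrArg Neg.neg (hinit x))
  refine ⟨fun x => ⟨a1 x, by linarith [b1 x]⟩, fun x hx => a2 x ?_, fun x hx => ?_⟩
  · have := mul_le_mul_of_nonneg_right (le_max_left M₁ M₂) hε.le
    linarith
  · have := mul_le_mul_of_nonneg_right (le_max_right M₁ M₂) hε.le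
    linarith [b2 x (by linarith)]
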